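/- Fix a, ρ, λ, μ with ρ > 0, μ > 0, λ + μ > 0, a > 0, and let ν = λ/(2(λ+μ)). In the perfectly bonded case Z_S = Z_T, regard the displacement tensor U = U_ω as a function of ω > 0, with Z defined by the lumped formula. Then for every x ∈ ℝ³ with r = |x| ≥ a and x̂ = x/r: lim_{ω→0⁺} U_ω(x) = (3a/(2r(5−6ν))) [ (3 − 4ν + a²/(3r²)) I + (1 − a²/r²) x̂⊗x̂ ]. (This is the static displacement field of a rigid immovable bonded sphere, agreeing with Walpole's elastostatic result.) -/

import Mathlib

open Complex Matrix Filter Topology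

/-- Outer product matrix `r̂ ⊗ r̂` (complexified) of the unit radial direction of `x`. -/
noncomputable def outerUnit (x : EuclideanSpace ℝ (Fin 3)) : Matrix (Fin 3) (Fin 3) ℂ :=
  Matrix.of fun i j => (((x i / ‖x‖) * (x j / ‖x‖) : ℝ) : ℂ)

/-- The displacement tensor `U(r)` of a spherical inclusion, Eq. (471) of the paper. -/
noncomputable def Udisp (a k h : ℝ) (Z ZM ZL ZS ZT : ℂ)
    (x : EuclideanSpace ℝ (Fin 3)) : Matrix (Fin 3) (Fin 3) ℂ :=
  ((Z + ZM) * ((a : ℂ) / (‖x‖ : ℂ))) •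
    ((Complex.exp (I * k * ((‖x‖ : ℝ) - a)) / (ZL + ZM)) •
        ((1 / ((k : ℂ) * ‖x‖) ^ 2 - I / ((k : ℂ) * ‖x‖)) • (1 : Matrix (Fin 3) (Fin 3) ℂ)
          + (1 + 3 * I / ((k : ℂ) * ‖x‖) - 3 / ((k : ℂ) * ‖x‖) ^ 2) • outerUnit x)
      + (ZS / ZT * Complex.exp (I * h * ((‖x‖ : ℝ) - a)) / (ZS + ZM)) •
        ((1 + I / ((h : ℂ) * ‖x‖) - 1 / ((h : ℂ) * ‖x‖) ^ 2) • (1 : Matrix (Fin 3) (Fin 3) ℂ)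
          - (1 + 3 * I / ((h : ℂ) * ‖x‖) - 3 / ((h : ℂ) * ‖x‖) ^ 2) • outerUnit x))

/-- Mass-like impedance `Z_M = iω(4/3)πa³ρ`. -/
noncomputable def ZMf (a ρ ω : ℝ) : ℂ := I * ω * (4 / 3) * Real.pi * a ^ 3 * ρ

/-- Longitudinal impedance `Z_L = (iω)⁻¹ 4πa(λ+2μ)(1−ika)`, `k = ω/c_L`. -/
noncomputable def ZLf (a ρ lam mu ω : ℝ) : ℂ :=
  (I * ω)⁻¹ * (4 * Real.pi * a * (lam + 2 * mu))
    * (1 - I * (ω / Real.sqrt ((lam + 2 * mu) / ρ)) * a)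

/-- Transverse impedance `Z_T = (iω)⁻¹ 4πaμ(1−iha)`, `h = ω/c_T`. -/
noncomputable def ZTf (a ρ mu ω : ℝ) : ℂ :=
  (I * ω)⁻¹ * (4 * Real.pi * a * mu) * (1 - I * (ω / Real.sqrt (mu / ρ)) * a)

/-- The sphere impedance `Z` given by the lumped formula
`3/(Z+Z_M) = 1/(Z_L+Z_M) + 2/(Z_S+Z_M)`. -/
noncomputable def Zsphere (ZM ZL ZS : ℂ) : ℂ :=
  3 / (1 / (ZL + ZM) + 2 / (ZS + ZM)) - ZM


lemma exp_remainder : ∃ E : ℂ → ℂ, Tendsto E (𝓝 0) (𝓝 (1/2)) ∧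
    ∀ z, Complex.exp z = 1 + z + z^2 * E z := by
  refine ⟨fun z => if z = 0 then 1/2 else (Complex.exp z - 1 - z)/z^2, ?_, ?_⟩
  · rw [tendsto_iff_norm_sub_tendsto_zero]
    have hb : ∀ᶠ z : ℂ in 𝓝 0, ‖z‖ < 1 := by
      have : Tendsto (fun z : ℂ => ‖z‖) (𝓝 0) (𝓝 0) := by
        simpa using (continuous_norm (E := ℂ)).tendsto 0
      exact this.eventually_lt_const one_pos
    have ht : Tendsto (fun z : ℂ => ‖z‖ * 1) (𝓝 0) (𝓝 0) := by
      simpa using (continuous_norm (E := ℂ)).tendsto 0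
    refine squeeze_zero' (Eventually.of_forall fun _ => norm_nonneg _) ?_ ht
    filter_upwards [hb] with z hz
    by_cases h : z = 0
    · simp [h]
    · simp only [h, if_false]
      have h3 := Complex.exp_bound (x := z) hz.le (n := 3) (by norm_num)
      simp only [Finset.sum_range_succ, Finset.sum_range_zero] at h3
      norm_num [Nat.factorial] at h3
      have e : (Complex.exp z - 1 - z)/z^2 - 1/2 = (Complex.exp z - (1 + z + z^2/2))/z^2 := by
        field_simp; ring
      have hz0 : 0 < ‖z‖ := norm_pos_iff.mpr h
      rw [e, norm_div, norm_pow, div_le_iff₀ (by positivity)]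
      refine h3.trans ?_
      have : 0 < ‖z‖^3 := by positivity
      nlinarith
  · intro z
    by_cases h : z = 0
    · simp [h]
    · simp only [h, if_false]; field_simp; ring

lemma denom_tendsto (a c : ℝ) :
    Tendsto (fun ω : ℝ => 1 - I * ((ω:ℂ)/c) * a - ((ω:ℂ)/c*a)^2/3) (𝓝[>] 0) (𝓝 1) := by
  have : Continuous (fun ω : ℝ => 1 - I * ((ω:ℂ)/c) * a - ((ω:ℂ)/c*a)^2/3) := by fun_prop
  have h := this.tendsto 0
  simp at h
  exact (by simpa using h : Tendsto _ _ _).mono_left nhdsWithin_le_nhds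

lemma exp_tendsto (d : ℂ) (c : ℝ) :
    Tendsto (fun ω : ℝ => Complex.exp (I * ((ω:ℂ)/c) * d)) (𝓝[>] 0) (𝓝 1) := by
  have : Continuous (fun ω : ℝ => Complex.exp (I * ((ω:ℂ)/c) * d)) := by fun_prop
  have h := this.tendsto 0
  simp at h
  exact (by simpa using h : Tendsto _ _ _).mono_left nhdsWithin_le_nhds

lemma radial_expansion (a r c : ℝ) : ∃ f : ℝ → ℂ,
    Tendsto f (𝓝[>] 0) (𝓝 ((r:ℂ)^2/2 - (a:ℂ)^2/6)) ∧
    ∀ ω : ℝ, (1 - I * ((ω:ℂ)/c) * a - ((ω:ℂ)/c*a)^2/3) ≠ 0 →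
      Complex.exp (I * ((ω:ℂ)/c) * ((r:ℂ) - a)) * (1 - I * ((ω:ℂ)/c) * r) /
        (1 - I * ((ω:ℂ)/c) * a - ((ω:ℂ)/c*a)^2/3) = 1 + ((ω:ℂ)/c)^2 * f ω := by
  obtain ⟨E, hE, hexp⟩ := exp_remainder
  refine ⟨fun ω => ((r:ℂ)*(r-a) + (a:ℂ)^2/3 - (1 - I * ((ω:ℂ)/c) * r) * ((r:ℂ)-a)^2 *
    E (I * ((ω:ℂ)/c) * ((r:ℂ) - a))) / (1 - I * ((ω:ℂ)/c) * a - ((ω:ℂ)/c*a)^2/3), ?_, ?_⟩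
  · have h1 : Tendsto (fun ω : ℝ => I * ((ω:ℂ)/c) * ((r:ℂ) - a)) (𝓝[>] 0) (𝓝 0) := by
      have : Continuous (fun ω : ℝ => I * ((ω:ℂ)/c) * ((r:ℂ) - a)) := by fun_prop
      have h := this.tendsto 0
      exact (by simpa using h : Tendsto _ _ _).mono_left nhdsWithin_le_nhds
    have h2 : Tendsto (fun ω : ℝ => (1 - I * ((ω:ℂ)/c) * r) * ((r:ℂ)-a)^2) (𝓝[>] 0)
        (𝓝 (((r:ℂ)-a)^2)) := by
      have : Continuous (fun ω : ℝ => (1 - I * ((ω:ℂ)/c) * r) * ((r:ℂ)-a)^2) := by fun_prop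
      have h := this.tendsto 0
      exact (by simpa using h : Tendsto _ _ _).mono_left nhdsWithin_le_nhds
    have h3 := ((tendsto_const_nhds (x := (r:ℂ)*(r-a) + (a:ℂ)^2/3)).sub
      (h2.mul (hE.comp h1))).div (denom_tendsto a c) one_ne_zero
    have e : (r:ℂ)^2/2 - (a:ℂ)^2/6 =
        ((r:ℂ) * (r - a) + (a:ℂ) ^ 2 / 3 - ((r:ℂ) - a) ^ 2 * (1 / 2)) / 1 := by ring
    rw [e]
    exact h3
  · intro ω hp
    simp only
    rw [hexp, div_eq_iff hp, add_mul 1, mul_assoc (((ω:ℂ)/c)^2), div_mul_cancel₀ _ hp]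
    generalize (ω:ℂ)/c = k
    linear_combination (-k^2*r*(r-a) + k^2*(r-a)^2*E (I * k * ((r:ℂ) - a))*(1-I*k*r)) * I_sq

lemma coeff_alg (a r ω cL cT K p q E1 E2 f1 f2 : ℂ) (hr : r ≠ 0) (hω : ω ≠ 0) (hL : cL ≠ 0)
    (hT : cT ≠ 0) (hK : K ≠ 0) (hp : p ≠ 0) (hq : q ≠ 0)
    (h1 : E1 * (1 - I * (ω/cL) * r) / p = 1 + (ω/cL)^2 * f1)
    (h2 : E2 * (1 - I * (ω/cT) * r) / q = 1 + (ω/cT)^2 * f2) :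
    (E1 / (K * cL^2 * p) * (1 / (ω/cL*r)^2 - I/(ω/cL*r)) +
      E2 / (K * cT^2 * q) * (1 + I/(ω/cT*r) - 1/(ω/cT*r)^2)) =
      K⁻¹ * ((f1/cL^2 - f2/cT^2)/r^2 + E2/q/cT^2) ∧
    (E1 / (K * cL^2 * p) * (1 + 3*I/(ω/cL*r) - 3 / (ω/cL*r)^2) -
      E2 / (K * cT^2 * q) * (1 + 3*I/(ω/cT*r) - 3/(ω/cT*r)^2)) =
      K⁻¹ * (E1/p/cL^2 - E2/q/cT^2 - 3*(f1/cL^2 - f2/cT^2)/r^2) := by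
  have g1 : E1 / (K * cL^2 * p) * (1 / (ω/cL*r)^2 - I/(ω/cL*r)) =
      K⁻¹ * (1/(ω*r)^2 + f1/cL^2/r^2) := by
    calc _ = K⁻¹ * (E1 * (1 - I * (ω/cL) * r) / p) / (ω*r)^2 := by field_simp
      _ = _ := by rw [h1]; field_simp
  have g2 : E2 / (K * cT^2 * q) * (1 / (ω/cT*r)^2 - I/(ω/cT*r)) =
      K⁻¹ * (1/(ω*r)^2 + f2/cT^2/r^2) := by
    calc _ = K⁻¹ * (E2 * (1 - I * (ω/cT) * r) / q) / (ω*r)^2 := by field_simp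
      _ = _ := by rw [h2]; field_simp
  have e1 : E1 / (K * cL^2 * p) = K⁻¹ * (E1/p/cL^2) := by field_simp
  have e2 : E2 / (K * cT^2 * q) = K⁻¹ * (E2/q/cT^2) := by field_simp
  constructor
  · linear_combination g1 - g2 + e2
  · linear_combination -3*g1 + 3*g2 + e1 - e2

/-- Quasistatic limit of the displacement tensor for a perfectly bonded sphere,
Eq. (90) of the paper (with `χ = 0`): as `ω → 0⁺`,
`U(x) → (3a/(2r(5−6ν)))[(3−4ν+a²/(3r²)) I + (1−a²/r²) x̂⊗x̂]`, where
`ν = λ/(2(λ+μ))` is the Poisson ratio; this is Walpole's static result for a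
rigid immovable bonded sphere. -/
theorem quasistatic_displacement_tensor (a ρ lam mu : ℝ)
    (ha : 0 < a) (hρ : 0 < ρ) (hmu : 0 < mu) (hlm : 0 < lam + mu)
    (ν : ℝ) (hν : ν = lam / (2 * (lam + mu)))
    (x : EuclideanSpace ℝ (Fin 3)) (hx : a ≤ ‖x‖) :
    Tendsto (fun ω : ℝ =>
        Udisp a (ω / Real.sqrt ((lam + 2 * mu) / ρ)) (ω / Real.sqrt (mu / ρ))
          (Zsphere (ZMf a ρ ω) (ZLf a ρ lam mu ω) (ZTf a ρ mu ω))
          (ZMf a ρ ω) (ZLf a ρ lam mu ω) (ZTf a ρ mu ω) (ZTf a ρ mu ω) x)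
      (𝓝[>] 0)
      (𝓝 ((((3 * a / (2 * ‖x‖ * (5 - 6 * ν)) : ℝ) : ℂ)) •
            ((((3 - 4 * ν + a ^ 2 / (3 * ‖x‖ ^ 2) : ℝ) : ℂ)) • (1 : Matrix (Fin 3) (Fin 3) ℂ)
              + (((1 - a ^ 2 / ‖x‖ ^ 2 : ℝ) : ℂ)) • outerUnit x))) := by
  
  have hr : 0 < ‖x‖ := lt_of_lt_of_le ha hx
  have hL : 0 < lam + 2 * mu := by linarith
  have hcL2 : Real.sqrt ((lam + 2 * mu) / ρ) ^ 2 * ρ = lam + 2 * mu := by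
    rw [Real.sq_sqrt (by positivity)]; field_simp
  have hcT2 : Real.sqrt (mu / ρ) ^ 2 * ρ = mu := by
    rw [Real.sq_sqrt (by positivity)]; field_simp
  have hcL : 0 < Real.sqrt ((lam + 2 * mu) / ρ) := by positivity
  have hcT : 0 < Real.sqrt (mu / ρ) := by positivity
  unfold ZLf ZTf Udisp
  generalize Real.sqrt ((lam + 2 * mu) / ρ) = cL at *
  generalize Real.sqrt (mu / ρ) = cT at *
  generalize outerUnit x = o
  generalize ‖x‖ = r at *
  obtain ⟨f1, hf1, hF1⟩ := radial_expansion a r cL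
  obtain ⟨f2, hf2, hF2⟩ := radial_expansion a r cT
  have hp := denom_tendsto a cL
  have hq := denom_tendsto a cT
  have hE1 := exp_tendsto ((r:ℂ) - a) cL
  have hE2 := exp_tendsto ((r:ℂ) - a) cT
  have hrC : (r:ℂ) ≠ 0 := by exact_mod_cast hr.ne'
  have haC : (a:ℂ) ≠ 0 := by exact_mod_cast ha.ne'
  have hρC : (ρ:ℂ) ≠ 0 := by exact_mod_cast hρ.ne'
  have hmC : (mu:ℂ) ≠ 0 := by exact_mod_cast hmu.ne'
  have hLC : (cL:ℂ) ≠ 0 := by exact_mod_cast hcL.ne'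
  have hTC : (cT:ℂ) ≠ 0 := by exact_mod_cast hcT.ne'
  have hpiC : (Real.pi:ℂ) ≠ 0 := by exact_mod_cast Real.pi_ne_zero
  have hcL2C : (cL:ℂ)^2 * ρ = lam + 2 * mu := by exact_mod_cast hcL2
  have hcT2C : (cT:ℂ)^2 * ρ = mu := by exact_mod_cast hcT2
  have hden : 1/((cL:ℂ)^2*1) + 2/((cT:ℂ)^2*1) ≠ 0 := by
    have : (0:ℝ) < 1/(cL^2*1) + 2/(cT^2*1) := by positivity
    exact_mod_cast this.ne'
  have hS := ((tendsto_const_nhds (x := (3:ℂ))).div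
    (((tendsto_const_nhds (x := (1:ℂ))).div ((tendsto_const_nhds (x := (cL:ℂ)^2)).mul hp)
      (by simpa using hLC)).add
    ((tendsto_const_nhds (x := (2:ℂ))).div ((tendsto_const_nhds (x := (cT:ℂ)^2)).mul hq)
      (by simpa using hTC))) hden).mul (tendsto_const_nhds (x := (a:ℂ)/r))
  have hD := ((hf1.div_const ((cL:ℂ)^2)).sub (hf2.div_const ((cT:ℂ)^2)))
  have hA := (hE1.div hp one_ne_zero).div_const ((cL:ℂ)^2)
  have hB := (hE2.div hq one_ne_zero).div_const ((cT:ℂ)^2)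
  have hlim := ((hS.mul ((hD.div_const ((r:ℂ)^2)).add hB)).smul_const
      (1 : Matrix (Fin 3) (Fin 3) ℂ)).add
    ((hS.mul ((hA.sub hB).sub ((hD.const_mul 3).div_const ((r:ℂ)^2)))).smul_const o)
  refine Eq.subst (motive := fun z => Tendsto _ _ (𝓝 z)) ?_ (hlim.congr' ?_)
  rotate_left
  · filter_upwards [self_mem_nhdsWithin, hp.eventually_ne one_ne_zero,
      hq.eventually_ne one_ne_zero] with ω hω hpω hqω
    have hω0 : (ω:ℂ) ≠ 0 := by exact_mod_cast (ne_of_gt hω)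
    have g1 := hF1 ω hpω
    have g2 := hF2 ω hqω
    have hZT : (I * (ω:ℂ))⁻¹ * (4 * Real.pi * a * mu) * (1 - I * (ω / cT) * a) ≠ 0 := by
      have h1 : (1 - I * ((ω:ℂ) / cT) * a) ≠ 0 := by
        intro h
        have h' : (1 - I * (((ω / cT * a : ℝ)) : ℂ)) = 0 := by
          rw [← h]; push_cast; ring
        have := congrArg Complex.re h'
        simp at this
      have : (I * (ω:ℂ)) ≠ 0 := mul_ne_zero I_ne_zero hω0
      exact mul_ne_zero (mul_ne_zero (inv_ne_zero this)
        (mul_ne_zero (mul_ne_zero (mul_ne_zero (by norm_num) hpiC) haC) hmC)) h1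
    have hK : (I * (ω:ℂ))⁻¹ * (4 * Real.pi * a * ρ) ≠ 0 := by
      have : (I * (ω:ℂ)) ≠ 0 := mul_ne_zero I_ne_zero hω0
      exact mul_ne_zero (inv_ne_zero this)
        (mul_ne_zero (mul_ne_zero (mul_ne_zero (by norm_num) hpiC) haC) hρC)
    have hII : (I * (ω:ℂ))⁻¹ * ω^2 = - (I * ω) := by
      field_simp; simp
    have eL : (I * (ω:ℂ))⁻¹ * (4 * Real.pi * a * (lam + 2 * mu)) * (1 - I * (ω / cL) * a)
        + ZMf a ρ ω = ((I * (ω:ℂ))⁻¹ * (4 * Real.pi * a * ρ)) * cL^2 *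
          (1 - I * ((ω:ℂ)/cL) * a - ((ω:ℂ)/cL*a)^2/3) := by
      unfold ZMf
      rw [← hcL2C]
      have : (cL:ℂ)^2 * ((ω:ℂ)/cL*a)^2 = ω^2*a^2 := by field_simp
      linear_combination (4 * Real.pi * a * ρ) * (I * (ω:ℂ))⁻¹ /3 * this +
        4 * Real.pi * a^3 * ρ/3 * hII
    have eT : (I * (ω:ℂ))⁻¹ * (4 * Real.pi * a * mu) * (1 - I * (ω / cT) * a)
        + ZMf a ρ ω = ((I * (ω:ℂ))⁻¹ * (4 * Real.pi * a * ρ)) * cT^2 *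
          (1 - I * ((ω:ℂ)/cT) * a - ((ω:ℂ)/cT*a)^2/3) := by
      unfold ZMf
      rw [← hcT2C]
      have : (cT:ℂ)^2 * ((ω:ℂ)/cT*a)^2 = ω^2*a^2 := by field_simp
      linear_combination (4 * Real.pi * a * ρ) * (I * (ω:ℂ))⁻¹ /3 * this +
        4 * Real.pi * a^3 * ρ/3 * hII
    unfold Zsphere
    rw [sub_add_cancel, div_self hZT, eL, eT]
    simp only [Complex.ofReal_div, Complex.ofReal_sub, one_mul]
    simp only [Pi.div_apply]
    generalize (I * (ω:ℂ))⁻¹ * (4 * Real.pi * a * ρ) = K at *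
    generalize (1 - I * ((ω:ℂ)/cL) * a - ((ω:ℂ)/cL*a)^2/3) = p at *
    generalize (1 - I * ((ω:ℂ)/cT) * a - ((ω:ℂ)/cT*a)^2/3) = q at *
    generalize Complex.exp (I * ((ω:ℂ)/cL) * ((r:ℂ) - a)) = E1 at *
    generalize Complex.exp (I * ((ω:ℂ)/cT) * ((r:ℂ) - a)) = E2 at *
    obtain ⟨c1, c2⟩ := coeff_alg a r ω cL cT K p q E1 E2 (f1 ω) (f2 ω) hrC hω0 hLC hTC hK hpω hqω
      g1 g2
    have hSK : 3 / (1 / (K * cL^2 * p) + 2 / (K * cT^2 * q)) =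
        K * (3 / (1 / (cL^2 * p) + 2 / (cT^2 * q))) := by
      have : 1 / (K * cL^2 * p) + 2 / (K * cT^2 * q) =
        K⁻¹ * (1 / (cL^2 * p) + 2 / (cT^2 * q)) := by field_simp
      rw [this, div_mul_eq_div_div, div_inv_eq_mul]; ring
    rw [hSK]
    generalize (3 / (1 / ((cL:ℂ)^2 * p) + 2 / ((cT:ℂ)^2 * q))) = S at *
    have d1 := congrArg (fun z => K * S * (a/r) * z) c1
    have d2 := congrArg (fun z => K * S * (a/r) * z) c2
    rw [show ∀ z, K * S * ((a:ℂ)/r) * (K⁻¹ * z) = S * (a/r) * z by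
      intro z; field_simp] at d1 d2
    rw [← d1, ← d2]
    module
  · rw [smul_add, smul_smul, smul_smul]
    have h5 : 5 - 6 * ν ≠ 0 := by
      have : 5 - 6 * ν = (2 * lam + 5 * mu)/(lam+mu) := by rw [hν]; field_simp; ring
      rw [this]
      have : 0 < 2 * lam + 5 * mu := by linarith
      positivity
    have hx1 : 3 / (1/(cL^2*1) + 2/(cT^2*1)) * (a/r) *
        (((r^2/2-a^2/6)/cL^2 - (r^2/2-a^2/6)/cT^2)/r^2 + 1/1/cT^2) =
        3 * a / (2 * r * (5 - 6 * ν)) * (3 - 4 * ν + a ^ 2 / (3 * r ^ 2)) := by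
      have q1 : cL^2 = (lam+2*mu)/ρ := by field_simp; linarith
      have q2 : cT^2 = mu/ρ := by field_simp; linarith
      have h6 : 5 - 6 * ν = (2 * lam + 5 * mu)/(lam+mu) := by rw [hν]; field_simp; ring
      have h7 : 0 < 2 * lam + 5 * mu := by linarith
      have h8 : 1/((lam+2*mu)/ρ*1) + 2/(mu/ρ*1) = ρ*(2*lam+5*mu)/((lam+2*mu)*mu) := by
        field_simp; ring
      rw [q1, q2, h6, h8]
      try rw [hν]
      field_simp
      ring
    have hx2 : 3 / (1/(cL^2*1) + 2/(cT^2*1)) * (a/r) *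
        (1/1/cL^2 - 1/1/cT^2 - 3*((r^2/2-a^2/6)/cL^2 - (r^2/2-a^2/6)/cT^2)/r^2) =
        3 * a / (2 * r * (5 - 6 * ν)) * (1 - a ^ 2 / r ^ 2) := by
      have q1 : cL^2 = (lam+2*mu)/ρ := by field_simp; linarith
      have q2 : cT^2 = mu/ρ := by field_simp; linarith
      have h6 : 5 - 6 * ν = (2 * lam + 5 * mu)/(lam+mu) := by rw [hν]; field_simp; ring
      have h7 : 0 < 2 * lam + 5 * mu := by linarith
      have h8 : 1/((lam+2*mu)/ρ*1) + 2/(mu/ρ*1) = ρ*(2*lam+5*mu)/((lam+2*mu)*mu) := by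
        field_simp; ring
      rw [q1, q2, h6, h8]
      try rw [hν]
      field_simp
      ring
    have hy1 := congrArg (fun z : ℝ => (z:ℂ)) hx1
    have hy2 := congrArg (fun z : ℝ => (z:ℂ)) hx2
    rw [← Complex.ofReal_mul, ← Complex.ofReal_mul, ← hy1, ← hy2]
    push_cast
    rfl
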